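/- Let m_1, m_2, m_3 be nonnegative reals and let x be a fractional uncoded placement for cache sizes m_1, m_2, m_3 (so x is indexed by the nonempty subsets of {1,2,3}). Then 2(x_{{1}} + x_{{2}} + x_{{3}}) + x_{{2,3}} ≥ max{ 3 − 2m_1 − m_2 − m_3, 1 − m_1 }. -/

import Mathlib

/-- A fractional uncoded placement for cache sizes `m 1, …, m K`: a family of
nonnegative reals indexed by the nonempty subsets `S` of `{1,…,K}` summing to `1`
and such that the total mass of the sets containing user `k` is at most `m k`. -/
def FracPlacement (K : ℕ) (m : ℕ → ℝ) (x : Finset ℕ → ℝ) : Prop :=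
  (∀ S ∈ (Finset.Icc 1 K).powerset.erase ∅, 0 ≤ x S) ∧
  (∑ S ∈ (Finset.Icc 1 K).powerset.erase ∅, x S = 1) ∧
  (∀ k ∈ Finset.Icc 1 K,
    ∑ S ∈ ((Finset.Icc 1 K).powerset.erase ∅).filter (fun S => k ∈ S), x S ≤ m k)

/-- The nonempty subsets of `{1, 2, 3}`, listed explicitly. -/
theorem powerset_Icc_one_three_erase_empty :
    (Finset.Icc 1 3).powerset.erase ∅ =
      ({{1}, {2}, {3}, {1, 2}, {1, 3}, {2, 3}, {1, 2, 3}} : Finset (Finset ℕ)) := by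
  decide

/-- A sum over the nonempty subsets of `{1, 2, 3}`, written out term by term. -/
theorem sum_powerset_Icc_one_three_erase_empty (f : Finset ℕ → ℝ) :
    ∑ S ∈ (Finset.Icc 1 3).powerset.erase ∅, f S =
      f {1} + f {2} + f {3} + f {1, 2} + f {1, 3} + f {2, 3} + f {1, 2, 3} := by
  rw [powerset_Icc_one_three_erase_empty]
  repeat rw [Finset.sum_insert (by decide)]
  rw [Finset.sum_singleton]
  ring

/-- three-user converse bound from the ordered permutation weights:
`2(x_{{1}}+x_{{2}}+x_{{3}}) + x_{{2,3}} ≥ max{3 − 2m_1 − m_2 − m_3, 1 − m_1}`. -/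
theorem stmt_18 (m : ℕ → ℝ) (hm : ∀ k ∈ Finset.Icc 1 3, 0 ≤ m k)
    (x : Finset ℕ → ℝ) (hx : FracPlacement 3 m x) :
    2 * (x {1} + x {2} + x {3}) + x {2, 3} ≥
      max (3 - 2 * m 1 - m 2 - m 3) (1 - m 1) := by
  obtain ⟨hnonneg, hsum, hcap⟩ := hx
  rw [sum_powerset_Icc_one_three_erase_empty] at hsum
  simp only [Finset.sum_filter, sum_powerset_Icc_one_three_erase_empty] at hcap
  have h1 := hcap 1 (by decide)
  have h2 := hcap 2 (by decide)
  have h3 := hcap 3 (by decide)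
  simp at h1 h2 h3
  have n1 := hnonneg {1} (by decide)
  have n2 := hnonneg {2} (by decide)
  have n3 := hnonneg {3} (by decide)
  have n123 := hnonneg {1, 2, 3} (by decide)
  exact max_le (by linarith) (by linarith)
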